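/- arXiv:2201.04266 — 2 statements merged into one kernel-verified Lean document; each statement's English description precedes it below -/
import Mathlib

section
/- For every two-player finite strategic-form game G and every pair of parameters ε₁, ε₂ ∈ [0,1], there exists an ε-safe equilibrium of G. -/
open Finset

/-- Expected utility in a two-player strategic-form game, extended bilinearly. -/
def EU {S1 S2 : Type*} [Fintype S1] [Fintype S2] (u : S1 → S2 → ℝ)
    (σ1 : S1 → ℝ) (σ2 : S2 → ℝ) : ℝ :=
  ∑ a : S1, ∑ b : S2, σ1 a * σ2 b * u a b

/-- `(σ1, σ2)` is an `(ε1, ε2)`-safe equilibrium of the two-player game `(u1, u2)`. -/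
def IsSafeEq {S1 S2 : Type*} [Fintype S1] [Fintype S2]
    (u1 u2 : S1 → S2 → ℝ) (ε1 ε2 : ℝ) (σ1 : S1 → ℝ) (σ2 : S2 → ℝ) : Prop :=
  ∃ τ1 ρ1 : S1 → ℝ, ∃ τ2 ρ2 : S2 → ℝ,
    τ1 ∈ stdSimplex ℝ S1 ∧ ρ1 ∈ stdSimplex ℝ S1 ∧
    τ2 ∈ stdSimplex ℝ S2 ∧ ρ2 ∈ stdSimplex ℝ S2 ∧
    σ1 = (fun s => ε1 * τ1 s + (1 - ε1) * ρ1 s) ∧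
    σ2 = (fun s => ε2 * τ2 s + (1 - ε2) * ρ2 s) ∧
    (∀ σ ∈ stdSimplex ℝ S1, EU u1 σ σ2 ≤ EU u1 ρ1 σ2) ∧
    (∀ σ ∈ stdSimplex ℝ S1, EU u2 τ1 σ2 ≤ EU u2 σ σ2) ∧
    (∀ σ ∈ stdSimplex ℝ S2, EU u2 σ1 σ ≤ EU u2 σ1 ρ2) ∧
    (∀ σ ∈ stdSimplex ℝ S2, EU u1 σ1 τ2 ≤ EU u1 σ1 σ)

/-- `(σ1, σ2)` is a Nash equilibrium of the two-player game `(u1, u2)`. -/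
def IsNash {S1 S2 : Type*} [Fintype S1] [Fintype S2]
    (u1 u2 : S1 → S2 → ℝ) (σ1 : S1 → ℝ) (σ2 : S2 → ℝ) : Prop :=
  σ1 ∈ stdSimplex ℝ S1 ∧ σ2 ∈ stdSimplex ℝ S2 ∧
  (∀ σ ∈ stdSimplex ℝ S1, EU u1 σ σ2 ≤ EU u1 σ1 σ2) ∧
  (∀ σ ∈ stdSimplex ℝ S2, EU u2 σ1 σ ≤ EU u2 σ1 σ2)

open MeasureTheory Polynomial in
theorem exists_polynomial_eval_eq_setIntegral {X : Type*} [TopologicalSpace X] [T2Space X]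
    [MeasurableSpace X] [OpensMeasurableSpace X] (μ : Measure X) [IsFiniteMeasureOnCompacts μ]
    {K : Set X} (hK : IsCompact K) (p : (C(X, ℝ))[X]) :
    ∃ q : ℝ[X], ∀ t : ℝ,
      q.eval t = ∫ x in K, p.eval₂ ((Pi.evalRingHom (fun _ : X => ℝ) x).comp
        ContinuousMap.coeFnRingHom) t ∂μ := by
  refine ⟨∑ k ∈ p.support, Polynomial.monomial k (∫ x in K, p.coeff k x ∂μ), fun t => ?_⟩
  simp only [Polynomial.eval₂_eq_sum, Polynomial.sum, Polynomial.eval_finsetSum,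
    Polynomial.eval_monomial]
  rw [integral_finsetSum]
  · refine Finset.sum_congr rfl fun k _ => ?_
    rw [← integral_mul_const]
    rfl
  · intro k _
    exact (((p.coeff k).continuous.mul continuous_const).continuousOn.integrableOn_compact hK)

/-- The map `x ↦ x - t • F x` sends a set outside which `F` vanishes bijectively to
itself when `t` is small. -/
theorem image_sub_smul_eq_self {E : Type*} [NormedAddCommGroup E] [NormedSpace ℝ E]
    [CompleteSpace E] {F : E → E} {L : NNReal} (hL : LipschitzWith L F) {t : ℝ}
    (ht : 0 ≤ t) (htL : t * L < 1) {K : Set E} (hK : ∀ x ∉ K, F x = 0) :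
    Function.Injective (fun x => x - t • F x) ∧ (fun x => x - t • F x) '' K = K := by
  have key : ∀ y : E, LipschitzWith (t.toNNReal * L) (fun x => y + t • F x) := by
    intro y
    refine LipschitzWith.of_dist_le_mul fun a b => ?_
    rw [dist_add_left, dist_smul₀, NNReal.coe_mul, Real.coe_toNNReal t ht, Real.norm_of_nonneg ht,
      mul_assoc]
    exact mul_le_mul_of_nonneg_left (hL.dist_le_mul a b) ht
  have hc : ∀ y : E, ContractingWith (t.toNNReal * L) (fun x => y + t • F x) := fun y =>
    ⟨by rw [← NNReal.coe_lt_coe, NNReal.coe_mul, Real.coe_toNNReal t ht]; simpa using htL, key y⟩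
  have hinj : Function.Injective (fun x => x - t • F x) := by
    intro a b hab
    simp only at hab
    refine (hc (a - t • F a)).fixedPoint_unique' (x := a) (y := b) ?_ ?_
    · simp [Function.IsFixedPt]
    · simp [Function.IsFixedPt, hab]
  refine ⟨hinj, Set.Subset.antisymm ?_ ?_⟩
  · rintro _ ⟨x, hx, rfl⟩
    by_contra h
    have h1 : (fun x => x - t • F x) (x - t • F x) = (fun x => x - t • F x) x := by
      simp [hK _ h]
    have h2 : x - t • F x = x := hinj h1
    exact h (by simpa only [h2] using hx)
  · intro y hy
    have h := (hc y).fixedPoint_isFixedPt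
    set x := ContractingWith.fixedPoint _ (hc y)
    have hxy : x - t • F x = y := by
      rw [sub_eq_iff_eq_add]; exact h.symm
    by_cases hx : x ∈ K
    · exact ⟨x, hx, hxy⟩
    · rw [hK x hx, smul_zero, sub_zero] at hxy
      exact absurd (hxy ▸ hy) hx

open MeasureTheory Polynomial in
theorem exists_polynomial_eval_eq_setIntegral_det {E : Type*} [NormedAddCommGroup E]
    [InnerProductSpace ℝ E] [FiniteDimensional ℝ E] [MeasurableSpace E] [BorelSpace E]
    (μ : Measure E) [IsFiniteMeasureOnCompacts μ] {K : Set E} (hK : IsCompact K) {F : E → E}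
    (hF : ContDiff ℝ 1 F) (B : ℝ) (m : ℕ) :
    ∃ q : ℝ[X], ∀ t : ℝ, q.eval t = ∫ x in K,
      (ContinuousLinearMap.id ℝ E - t • fderiv ℝ F x).det * (B - ‖x - t • F x‖ ^ 2) ^ m ∂μ := by
  let b := Module.finBasis ℝ E
  have hJ : Continuous (fderiv ℝ F) := hF.continuous_fderiv one_ne_zero
  have hFc : Continuous F := hF.continuous
  let J : Matrix (Fin (Module.finrank ℝ E)) (Fin (Module.finrank ℝ E)) C(E, ℝ) :=
    Matrix.of fun i j => ⟨fun x => b.equivFunL (fderiv ℝ F x (b j)) i, by fun_prop⟩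
  let c₀ : C(E, ℝ) := ⟨fun x => B - ‖x‖ ^ 2, by fun_prop⟩
  let c₁ : C(E, ℝ) := ⟨fun x => 2 * inner ℝ x (F x), by fun_prop⟩
  let c₂ : C(E, ℝ) := ⟨fun x => -‖F x‖ ^ 2, by fun_prop⟩
  obtain ⟨q, hq⟩ := exists_polynomial_eval_eq_setIntegral μ hK
    ((1 - J.map fun c => X * C c).det * (C c₀ + C c₁ * X + C c₂ * X ^ 2) ^ m)
  refine ⟨q, fun t => (hq t).trans (integral_congr_ae (Filter.Eventually.of_forall fun x => ?_))⟩
  simp only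
  rw [← Polynomial.coe_eval₂RingHom, map_mul, map_pow, RingHom.map_det]
  congr 1
  · rw [ContinuousLinearMap.det, ← LinearMap.det_toMatrix b]
    have hid : (LinearMap.toMatrix b b) (ContinuousLinearMap.id ℝ E : E →L[ℝ] E).toLinearMap = 1 :=
      LinearMap.toMatrix_id b
    rw [ContinuousLinearMap.toLinearMap_sub, map_sub, map_one, map_sub, hid]
    congr 2
    ext i j
    simp [LinearMap.toMatrix_apply, J]
    ring
  · congr 1
    rw [norm_sub_sq_real, norm_smul, inner_smul_right, mul_pow, Real.norm_eq_abs, sq_abs]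
    simp [c₀, c₁, c₂]
    ring

open MeasureTheory Polynomial Filter Topology in
/-- The degree of the map `x ↦ x - F x` is one, tested against powers of `B - ‖x‖ ^ 2`. -/
theorem setIntegral_det_id_sub_fderiv_mul_pow {E : Type*} [NormedAddCommGroup E]
    [InnerProductSpace ℝ E] [FiniteDimensional ℝ E] [MeasurableSpace E] [BorelSpace E]
    (μ : Measure E) [μ.IsAddHaarMeasure] {K : Set E} (hK : IsCompact K) {F : E → E}
    (hF : ContDiff ℝ 1 F) {L : NNReal} (hL : LipschitzWith L F) (hFK : ∀ x ∉ K, F x = 0)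
    (B : ℝ) (m : ℕ) :
    ∫ x in K, (ContinuousLinearMap.id ℝ E - fderiv ℝ F x).det * (B - ‖x - F x‖ ^ 2) ^ m ∂μ =
      ∫ x in K, (B - ‖x‖ ^ 2) ^ m ∂μ := by
  obtain ⟨q, hq⟩ := exists_polynomial_eval_eq_setIntegral_det μ hK hF B m
  have hdet : ∀ᶠ A : E →L[ℝ] E in 𝓝 (ContinuousLinearMap.id ℝ E), 0 < A.det := by
    refine ContinuousLinearMap.continuous_det.continuousAt.eventually_const_lt ?_
    simp [ContinuousLinearMap.det]
  obtain ⟨η, hη, hηdet⟩ := Metric.eventually_nhds_iff.1 hdet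
  have hsmall : ∀ᶠ t : ℝ in 𝓝[>] 0, 0 < t ∧ t * L < 1 ∧ t * L < η := by
    have h : Tendsto (fun t : ℝ => t * L) (𝓝[>] 0) (𝓝 0) := by
      have : Tendsto (fun t : ℝ => t * L) (𝓝 0) (𝓝 (0 * L)) :=
        (continuous_id.mul continuous_const).tendsto 0
      rw [zero_mul] at this
      exact this.mono_left nhdsWithin_le_nhds
    exact eventually_mem_nhdsWithin.and ((h.eventually_lt_const one_pos).and
      (h.eventually_lt_const hη))
  have hconst : q = C (∫ x in K, (B - ‖x‖ ^ 2) ^ m ∂μ) := by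
    obtain ⟨s, hs, hs'⟩ := mem_nhdsGT_iff_exists_Ioo_subset.1 hsmall
    refine Polynomial.eq_of_infinite_eval_eq _ _
      ((Set.Ioo_infinite hs).mono fun t ht => ?_)
    obtain ⟨ht0, ht1, ht2⟩ := hs' ht
    obtain ⟨hinj, himg⟩ := image_sub_smul_eq_self hL ht0.le ht1 hFK
    have hderiv : ∀ x ∈ K, HasFDerivWithinAt (fun x => x - t • F x)
        (ContinuousLinearMap.id ℝ E - t • fderiv ℝ F x) K x := fun x _ =>
      ((hasFDerivAt_id x).sub
        ((hF.differentiable one_ne_zero x).hasFDerivAt.const_smul t)).hasFDerivWithinAt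
    have hcv := integral_image_eq_integral_abs_det_fderiv_smul μ hK.measurableSet hderiv
      hinj.injOn fun y => (B - ‖y‖ ^ 2) ^ m
    rw [himg] at hcv
    rw [Set.mem_ofPred_eq, hq, eval_C, hcv]
    refine integral_congr_ae (Eventually.of_forall fun x => ?_)
    have hpos : 0 < (ContinuousLinearMap.id ℝ E - t • fderiv ℝ F x).det := by
      refine hηdet ?_
      rw [dist_eq_norm, sub_sub_cancel_left, norm_neg, norm_smul, Real.norm_of_nonneg ht0.le]
      exact (mul_le_mul_of_nonneg_left (norm_fderiv_le_of_lipschitz ℝ hL) ht0.le).trans_lt ht2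
    simp only [smul_eq_mul, abs_of_pos hpos]
  have h1 := hq 1
  rw [hconst, eval_C] at h1
  simpa using h1.symm

open MeasureTheory Filter Topology in
theorem exists_fixedPoint_of_hasCompactSupport {E : Type*} [NormedAddCommGroup E]
    [InnerProductSpace ℝ E] [FiniteDimensional ℝ E] {F : E → E}
    (hF : ContDiff ℝ 1 F) (hc : HasCompactSupport F) : ∃ x, F x = x := by
  by_contra! hne
  borelize E
  let μ : Measure E := Measure.addHaar
  obtain ⟨L, hL⟩ := hF.lipschitzWith_of_hasCompactSupport hc one_ne_zero
  obtain ⟨R, hR0, hR⟩ := hc.isCompact.isBounded.subset_closedBall_lt 0 0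
  let K := Metric.closedBall (0 : E) R
  have hK : IsCompact K := isCompact_closedBall 0 R
  have hKne : K.Nonempty := ⟨0, by simp [K, hR0.le]⟩
  have hFK : ∀ x ∉ K, F x = 0 := fun x hx => image_eq_zero_of_notMem_tsupport fun h => hx (hR h)
  have hFc : Continuous F := hF.continuous
  have hJ : Continuous (fderiv ℝ F) := hF.continuous_fderiv one_ne_zero
  have hcont : Continuous fun x => ‖x - F x‖ := by fun_prop
  obtain ⟨x₀, -, hx₀⟩ := hK.exists_isMinOn hKne hcont.continuousOn
  have hδ : 0 < ‖x₀ - F x₀‖ := norm_pos_iff.2 (sub_ne_zero.2 (hne x₀).symm)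
  set δ := ‖x₀ - F x₀‖
  obtain ⟨M, hM⟩ := hK.exists_bound_of_continuousOn hcont.continuousOn
  simp only [norm_norm] at hM
  have hdetc : Continuous fun x => (ContinuousLinearMap.id ℝ E - fderiv ℝ F x).det :=
    ContinuousLinearMap.continuous_det.comp (by fun_prop)
  obtain ⟨D, hD⟩ := hK.exists_bound_of_continuousOn hdetc.continuousOn
  have hD0 : 0 ≤ D := (norm_nonneg _).trans (hD 0 (by simp [K, hR0.le]))
  obtain ⟨r, hr0, hr⟩ := exists_between (lt_min hδ hR0)
  obtain ⟨hrδ, hrR⟩ := lt_min_iff.1 hr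
  set B := M ^ 2 + R ^ 2
  have hrB : r ^ 2 < B := by
    have := sq_nonneg M
    have : r ^ 2 < R ^ 2 := by gcongr
    simp only [B]; linarith
  have hδB : δ ^ 2 ≤ B := by
    have h1 : δ ≤ M := (hx₀ hKne.some_mem).trans (hM _ hKne.some_mem)
    have : δ ^ 2 ≤ M ^ 2 := by gcongr
    have := sq_nonneg R
    simp only [B]; linarith
  have hV : 0 < μ.real (Metric.closedBall (0 : E) r) :=
    ENNReal.toReal_pos (Metric.measure_closedBall_pos μ _ hr0).ne' measure_closedBall_lt_top.ne
  have hupper : ∀ m : ℕ, ∫ x in K,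
      (ContinuousLinearMap.id ℝ E - fderiv ℝ F x).det * (B - ‖x - F x‖ ^ 2) ^ m ∂μ ≤
      D * (B - δ ^ 2) ^ m * μ.real K := by
    intro m
    refine (Real.le_norm_self _).trans (norm_setIntegral_le_of_norm_le_const hK.measure_lt_top ?_)
    intro x hx
    rw [norm_mul, norm_pow]
    have h1 : δ ≤ ‖x - F x‖ := hx₀ hx
    have h2 : ‖x - F x‖ ^ 2 ≤ M ^ 2 := by gcongr; exact hM x hx
    have h3 : δ ^ 2 ≤ ‖x - F x‖ ^ 2 := by gcongr
    have h4 : ‖B - ‖x - F x‖ ^ 2‖ ≤ B - δ ^ 2 := by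
      rw [Real.norm_of_nonneg]
      · linarith
      · have := sq_nonneg R
        simp only [B]; linarith
    gcongr
    exact hD x hx
  have hlower : ∀ m : ℕ, μ.real (Metric.closedBall (0 : E) r) * (B - r ^ 2) ^ m ≤
      ∫ x in K, (B - ‖x‖ ^ 2) ^ m ∂μ := by
    intro m
    have hint : IntegrableOn (fun x : E => (B - ‖x‖ ^ 2) ^ m) K μ :=
      ContinuousOn.integrableOn_compact hK (by fun_prop)
    have hsub : Metric.closedBall (0 : E) r ⊆ K := Metric.closedBall_subset_closedBall hrR.le
    have hnonneg : ∀ x ∈ K, 0 ≤ (B - ‖x‖ ^ 2) ^ m := by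
      intro x hx
      have hx' : ‖x‖ ≤ R := by simpa [K] using hx
      have : ‖x‖ ^ 2 ≤ R ^ 2 := by gcongr
      have := sq_nonneg M
      exact pow_nonneg (by simp only [B]; linarith) m
    calc _ = ∫ _x in Metric.closedBall (0 : E) r, (B - r ^ 2) ^ m ∂μ := by
          rw [setIntegral_const, smul_eq_mul]
      _ ≤ ∫ x in Metric.closedBall (0 : E) r, (B - ‖x‖ ^ 2) ^ m ∂μ := by
          refine setIntegral_mono_on (integrableOn_const (measure_closedBall_lt_top.ne))
            (hint.mono_set hsub) measurableSet_closedBall fun x hx => ?_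
          have hx' : ‖x‖ ≤ r := by simpa using hx
          have : 0 ≤ B - r ^ 2 := by linarith
          gcongr
      _ ≤ _ := setIntegral_mono_set hint
          ((ae_restrict_iff' hK.measurableSet).2 (Eventually.of_forall hnonneg))
          (Eventually.of_forall hsub)
  have hmain : ∀ m : ℕ, μ.real (Metric.closedBall (0 : E) r) ≤
      D * μ.real K * ((B - δ ^ 2) / (B - r ^ 2)) ^ m := by
    intro m
    have h := (hlower m).trans
      ((setIntegral_det_id_sub_fderiv_mul_pow μ hK hF hL hFK B m).symm.le.trans (hupper m))
    have hpos : 0 < (B - r ^ 2) ^ m := pow_pos (by linarith) m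
    rw [div_pow, ← mul_div_assoc, le_div_iff₀ hpos]
    linarith
  have hlim : Tendsto (fun m : ℕ => D * μ.real K * ((B - δ ^ 2) / (B - r ^ 2)) ^ m) atTop
      (𝓝 (D * μ.real K * 0)) := by
    have h0 : 0 ≤ (B - δ ^ 2) / (B - r ^ 2) := div_nonneg (by linarith) (by linarith)
    refine (tendsto_pow_atTop_nhds_zero_of_lt_one h0 ?_).const_mul _
    rw [div_lt_one (by linarith)]
    have : r ^ 2 < δ ^ 2 := by gcongr
    linarith
  have := ge_of_tendsto' hlim hmain
  rw [mul_zero] at this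
  exact this.not_gt hV

theorem exists_fixedPoint_of_contDiff_of_norm_le {E : Type*} [NormedAddCommGroup E]
    [NormedSpace ℝ E] [FiniteDimensional ℝ E] {F : E → E} (hF : ContDiff ℝ 1 F) {M : ℝ}
    (hM : ∀ x, ‖F x‖ ≤ M) : ∃ x, F x = x := by
  have hM0 : 0 ≤ M := (norm_nonneg _).trans (hM 0)
  let χ : ContDiffBump (0 : E) := ⟨M + 1, M + 2, by linarith, by linarith⟩
  let e : E ≃L[ℝ] EuclideanSpace ℝ (Fin (Module.finrank ℝ E)) := toEuclidean
  have hχ : ContDiff ℝ 1 χ := χ.contDiff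
  have hG : ContDiff ℝ 1 fun y => e (χ (e.symm y) • F (e.symm y)) := by fun_prop
  have hc : HasCompactSupport fun y => e (χ (e.symm y) • F (e.symm y)) := by
    have h1 : HasCompactSupport fun x => χ x • F x := χ.hasCompactSupport.smul_right
    exact (h1.comp_homeomorph e.symm.toHomeomorph).comp_left (g := e) (map_zero e)
  obtain ⟨y, hy⟩ := exists_fixedPoint_of_hasCompactSupport hG hc
  have hx : χ (e.symm y) • F (e.symm y) = e.symm y := e.eq_symm_apply.2 hy
  refine ⟨e.symm y, ?_⟩
  have hmem : e.symm y ∈ Metric.closedBall (0 : E) (M + 1) := by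
    rw [mem_closedBall_zero_iff]
    nth_rw 1 [← hx]
    rw [norm_smul, Real.norm_of_nonneg χ.nonneg]
    calc _ ≤ 1 * M := mul_le_mul χ.le_one (hM _) (norm_nonneg _) zero_le_one
      _ ≤ M + 1 := by linarith
  rw [χ.one_of_mem_closedBall hmem, one_smul] at hx
  exact hx

/-- The logit choice rule for the payoff vector `v`. -/
noncomputable def softmax {S : Type*} [Fintype S] (v : S → ℝ) : S → ℝ :=
  fun a => Real.exp (v a) / ∑ b, Real.exp (v b)

theorem sum_exp_pos {S : Type*} [Fintype S] [Nonempty S] (v : S → ℝ) :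
    0 < ∑ b, Real.exp (v b) :=
  Finset.sum_pos (fun _ _ => Real.exp_pos _) Finset.univ_nonempty

theorem softmax_mem_stdSimplex {S : Type*} [Fintype S] [Nonempty S] (v : S → ℝ) :
    softmax v ∈ stdSimplex ℝ S := by
  refine ⟨fun a => div_nonneg (Real.exp_pos _).le (sum_exp_pos v).le, ?_⟩
  simp only [softmax]
  rw [← Finset.sum_div, div_self (sum_exp_pos v).ne']

@[fun_prop]
theorem contDiff_softmax {S : Type*} [Fintype S] [Nonempty S] :
    ContDiff ℝ 1 (softmax : (S → ℝ) → S → ℝ) := by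
  refine contDiff_pi.2 fun a => ContDiff.div (by fun_prop) (by fun_prop) fun v => ?_
  exact (sum_exp_pos v).ne'

/-- The logit choice rule is approximately optimal when payoffs are scaled up. -/
theorem sum_mul_le_sum_softmax_mul_add {S : Type*} [Fintype S] [Nonempty S] (v : S → ℝ) {c : ℝ}
    (hc : 0 < c) {σ : S → ℝ} (hσ : σ ∈ stdSimplex ℝ S) :
    ∑ a, σ a * v a ≤ ∑ a, softmax (fun b => c * v b) a * v a + Fintype.card S / c := by
  set p := softmax fun b => c * v b with hp_def
  have hp : p ∈ stdSimplex ℝ S := softmax_mem_stdSimplex _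
  have key : ∀ a b, p a * (v b - v a) ≤ 1 / c := by
    intro a b
    rw [le_div_iff₀ hc]
    calc p a * (v b - v a) * c = p a * (c * v b - c * v a) := by ring
      _ ≤ p a * Real.exp (c * v b - c * v a) :=
          mul_le_mul_of_nonneg_left ((lt_add_one _).le.trans (Real.add_one_le_exp _)) (hp.1 a)
      _ = p b := by
          rw [Real.exp_sub, hp_def]
          simp only [softmax]
          field_simp
      _ ≤ 1 := (mem_Icc_of_mem_stdSimplex hp b).2
  have hb : ∀ b, v b ≤ ∑ a, p a * v a + Fintype.card S / c := by
    intro b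
    have h := Finset.sum_le_sum fun a (_ : a ∈ Finset.univ) => key a b
    simp only [mul_sub, Finset.sum_sub_distrib, ← Finset.sum_mul, hp.2, one_mul, Finset.sum_const,
      Finset.card_univ, nsmul_eq_mul, mul_one_div] at h
    linarith
  calc ∑ a, σ a * v a ≤ ∑ a, σ a * (∑ a, p a * v a + Fintype.card S / c) :=
        Finset.sum_le_sum fun a _ => mul_le_mul_of_nonneg_left (hb a) (hσ.1 a)
    _ = _ := by rw [← Finset.sum_mul, hσ.2, one_mul]

theorem EU_eq_sum_left {S1 S2 : Type*} [Fintype S1] [Fintype S2] (u : S1 → S2 → ℝ)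
    (σ1 : S1 → ℝ) (σ2 : S2 → ℝ) : EU u σ1 σ2 = ∑ a, σ1 a * ∑ b, σ2 b * u a b := by
  simp only [EU, Finset.mul_sum, mul_assoc]

theorem EU_eq_sum_right {S1 S2 : Type*} [Fintype S1] [Fintype S2] (u : S1 → S2 → ℝ)
    (σ1 : S1 → ℝ) (σ2 : S2 → ℝ) : EU u σ1 σ2 = ∑ b, σ2 b * ∑ a, σ1 a * u a b := by
  rw [EU, Finset.sum_comm]
  simp only [Finset.mul_sum]
  exact Finset.sum_congr rfl fun b _ => Finset.sum_congr rfl fun a _ => by ring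

theorem convexCombo_mem_stdSimplex {S : Type*} [Fintype S] {ε : ℝ} (hε : ε ∈ Set.Icc (0 : ℝ) 1)
    {τ ρ : S → ℝ} (hτ : τ ∈ stdSimplex ℝ S) (hρ : ρ ∈ stdSimplex ℝ S) :
    (fun s => ε * τ s + (1 - ε) * ρ s) ∈ stdSimplex ℝ S :=
  convex_stdSimplex ℝ S hτ hρ hε.1 (sub_nonneg.2 hε.2) (add_sub_cancel ε 1)

theorem norm_le_one_of_mem_stdSimplex {S : Type*} [Fintype S] {σ : S → ℝ}
    (hσ : σ ∈ stdSimplex ℝ S) : ‖σ‖ ≤ 1 := by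
  refine (pi_norm_le_iff_of_nonneg zero_le_one).2 fun a => ?_
  rw [Real.norm_of_nonneg (hσ.1 a)]
  exact (mem_Icc_of_mem_stdSimplex hσ a).2

theorem exists_approx_safe_equilibrium {S1 S2 : Type*} [Fintype S1] [Fintype S2]
    [Nonempty S1] [Nonempty S2] (u1 u2 : S1 → S2 → ℝ) {ε1 ε2 : ℝ}
    (hε1 : ε1 ∈ Set.Icc (0 : ℝ) 1) (hε2 : ε2 ∈ Set.Icc (0 : ℝ) 1) {δ : ℝ} (hδ : 0 < δ) :
    ∃ τ1 ∈ stdSimplex ℝ S1, ∃ ρ1 ∈ stdSimplex ℝ S1,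
    ∃ τ2 ∈ stdSimplex ℝ S2, ∃ ρ2 ∈ stdSimplex ℝ S2,
    (∀ σ ∈ stdSimplex ℝ S1, EU u1 σ (fun s => ε2 * τ2 s + (1 - ε2) * ρ2 s) ≤
      EU u1 ρ1 (fun s => ε2 * τ2 s + (1 - ε2) * ρ2 s) + δ) ∧
    (∀ σ ∈ stdSimplex ℝ S1, EU u2 τ1 (fun s => ε2 * τ2 s + (1 - ε2) * ρ2 s) ≤
      EU u2 σ (fun s => ε2 * τ2 s + (1 - ε2) * ρ2 s) + δ) ∧
    (∀ σ ∈ stdSimplex ℝ S2, EU u2 (fun s => ε1 * τ1 s + (1 - ε1) * ρ1 s) σ ≤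
      EU u2 (fun s => ε1 * τ1 s + (1 - ε1) * ρ1 s) ρ2 + δ) ∧
    (∀ σ ∈ stdSimplex ℝ S2, EU u1 (fun s => ε1 * τ1 s + (1 - ε1) * ρ1 s) τ2 ≤
      EU u1 (fun s => ε1 * τ1 s + (1 - ε1) * ρ1 s) σ + δ) := by
  obtain ⟨c, hc, hc1, hc2⟩ : ∃ c : ℝ, 0 < c ∧ Fintype.card S1 / c ≤ δ ∧
      Fintype.card S2 / c ≤ δ := by
    have h1 : (0 : ℝ) < Fintype.card S1 := Nat.cast_pos.2 Fintype.card_pos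
    have h2 : (0 : ℝ) < Fintype.card S2 := Nat.cast_pos.2 Fintype.card_pos
    have hc : 0 < (Fintype.card S1 + Fintype.card S2 : ℝ) / δ := by positivity
    refine ⟨_, hc, ?_, ?_⟩ <;> rw [div_le_iff₀ hc, mul_div_cancel₀ _ hδ.ne'] <;> linarith
  let R1 : (S2 → ℝ) → S1 → ℝ := fun σ => softmax fun a => c * ∑ b, σ b * u1 a b
  let T1 : (S2 → ℝ) → S1 → ℝ := fun σ => softmax fun a => c * -∑ b, σ b * u2 a b
  let R2 : (S1 → ℝ) → S2 → ℝ := fun σ => softmax fun b => c * ∑ a, σ a * u2 a b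
  let T2 : (S1 → ℝ) → S2 → ℝ := fun σ => softmax fun b => c * -∑ a, σ a * u1 a b
  let F : (S1 → ℝ) × (S2 → ℝ) → (S1 → ℝ) × (S2 → ℝ) := fun x =>
    (fun s => ε1 * T1 x.2 s + (1 - ε1) * R1 x.2 s, fun s => ε2 * T2 x.1 s + (1 - ε2) * R2 x.1 s)
  have hR1 : ContDiff ℝ 1 R1 := contDiff_softmax.comp (by fun_prop)
  have hT1 : ContDiff ℝ 1 T1 := contDiff_softmax.comp (by fun_prop)
  have hR2 : ContDiff ℝ 1 R2 := contDiff_softmax.comp (by fun_prop)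
  have hT2 : ContDiff ℝ 1 T2 := contDiff_softmax.comp (by fun_prop)
  have hF : ContDiff ℝ 1 F := by fun_prop
  have hbound : ∀ x, ‖F x‖ ≤ 1 := fun x => norm_prod_le_iff.2
    ⟨norm_le_one_of_mem_stdSimplex (convexCombo_mem_stdSimplex hε1
        (softmax_mem_stdSimplex _) (softmax_mem_stdSimplex _)),
      norm_le_one_of_mem_stdSimplex (convexCombo_mem_stdSimplex hε2
        (softmax_mem_stdSimplex _) (softmax_mem_stdSimplex _))⟩
  obtain ⟨⟨σ1, σ2⟩, hσ⟩ := exists_fixedPoint_of_contDiff_of_norm_le hF hbound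
  obtain ⟨h1, h2⟩ := Prod.mk.inj hσ
  refine ⟨T1 σ2, softmax_mem_stdSimplex _, R1 σ2, softmax_mem_stdSimplex _,
    T2 σ1, softmax_mem_stdSimplex _, R2 σ1, softmax_mem_stdSimplex _, ?_⟩
  simp only at h1 h2
  rw [h1, h2]
  refine ⟨fun σ h => ?_, fun σ h => ?_, fun σ h => ?_, fun σ h => ?_⟩
  · have := sum_mul_le_sum_softmax_mul_add (fun a => ∑ b, σ2 b * u1 a b) hc h
    rw [EU_eq_sum_left, EU_eq_sum_left]
    linarith
  · have := sum_mul_le_sum_softmax_mul_add (fun a => -∑ b, σ2 b * u2 a b) hc h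
    simp only [mul_neg, Finset.sum_neg_distrib] at this
    simp only [EU_eq_sum_left, T1, mul_neg]
    linarith
  · have := sum_mul_le_sum_softmax_mul_add (fun b => ∑ a, σ1 a * u2 a b) hc h
    rw [EU_eq_sum_right, EU_eq_sum_right]
    linarith
  · have := sum_mul_le_sum_softmax_mul_add (fun b => -∑ a, σ1 a * u1 a b) hc h
    simp only [mul_neg, Finset.sum_neg_distrib] at this
    simp only [EU_eq_sum_right, T2, mul_neg]
    linarith

open Filter Topology in
theorem IsCompact.exists_forall_le_zero {X : Type*} [TopologicalSpace X]
    [FirstCountableTopology X] {K : Set X} (hK : IsCompact K) {G : Set (X → ℝ)}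
    (hG : ∀ g ∈ G, Continuous g) (h : ∀ δ > 0, ∃ x ∈ K, ∀ g ∈ G, g x ≤ δ) :
    ∃ x ∈ K, ∀ g ∈ G, g x ≤ 0 := by
  choose x hx hxG using fun n : ℕ => h (1 / (n + 1)) Nat.one_div_pos_of_nat
  obtain ⟨y, hy, φ, hφ, hlim⟩ := hK.tendsto_subseq hx
  refine ⟨y, hy, fun g hg => le_of_tendsto_of_tendsto' (((hG g hg).tendsto y).comp hlim)
    (tendsto_one_div_add_atTop_nhds_zero_nat.comp hφ.tendsto_atTop) fun n => hxG (φ n) g hg⟩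

theorem continuous_EU {X S1 S2 : Type*} [TopologicalSpace X] [Fintype S1] [Fintype S2]
    (u : S1 → S2 → ℝ) {f : X → S1 → ℝ} {g : X → S2 → ℝ} (hf : Continuous f) (hg : Continuous g) :
    Continuous fun x => EU u (f x) (g x) := by
  unfold EU
  fun_prop

/-- every two-player finite game has an ε-safe equilibrium for all
ε₁, ε₂ ∈ [0,1]. -/
theorem safe_equilibrium_exists_two_player
    {S1 S2 : Type*} [Fintype S1] [Fintype S2] [Nonempty S1] [Nonempty S2]
    (u1 u2 : S1 → S2 → ℝ) (ε1 ε2 : ℝ)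
    (hε1 : ε1 ∈ Set.Icc (0:ℝ) 1) (hε2 : ε2 ∈ Set.Icc (0:ℝ) 1) :
    ∃ σ1 σ2, σ1 ∈ stdSimplex ℝ S1 ∧ σ2 ∈ stdSimplex ℝ S2 ∧
      IsSafeEq u1 u2 ε1 ε2 σ1 σ2 := by
  let m1 : (S1 → ℝ) × (S1 → ℝ) × (S2 → ℝ) × (S2 → ℝ) → S1 → ℝ := fun x s =>
    ε1 * x.1 s + (1 - ε1) * x.2.1 s
  let m2 : (S1 → ℝ) × (S1 → ℝ) × (S2 → ℝ) × (S2 → ℝ) → S2 → ℝ := fun x s =>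
    ε2 * x.2.2.1 s + (1 - ε2) * x.2.2.2 s
  have hm1 : Continuous m1 := by fun_prop
  have hm2 : Continuous m2 := by fun_prop
  let g1 : (S1 → ℝ) → (S1 → ℝ) × (S1 → ℝ) × (S2 → ℝ) × (S2 → ℝ) → ℝ := fun σ x =>
    EU u1 σ (m2 x) - EU u1 x.2.1 (m2 x)
  let g2 : (S1 → ℝ) → (S1 → ℝ) × (S1 → ℝ) × (S2 → ℝ) × (S2 → ℝ) → ℝ := fun σ x =>
    EU u2 x.1 (m2 x) - EU u2 σ (m2 x)
  let g3 : (S2 → ℝ) → (S1 → ℝ) × (S1 → ℝ) × (S2 → ℝ) × (S2 → ℝ) → ℝ := fun σ x =>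
    EU u2 (m1 x) σ - EU u2 (m1 x) x.2.2.2
  let g4 : (S2 → ℝ) → (S1 → ℝ) × (S1 → ℝ) × (S2 → ℝ) × (S2 → ℝ) → ℝ := fun σ x =>
    EU u1 (m1 x) x.2.2.1 - EU u1 (m1 x) σ
  have hK : IsCompact (stdSimplex ℝ S1 ×ˢ stdSimplex ℝ S1 ×ˢ stdSimplex ℝ S2 ×ˢ stdSimplex ℝ S2) :=
    (isCompact_stdSimplex ℝ S1).prod ((isCompact_stdSimplex ℝ S1).prod
      ((isCompact_stdSimplex ℝ S2).prod (isCompact_stdSimplex ℝ S2)))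
  obtain ⟨⟨τ1, ρ1, τ2, ρ2⟩, ⟨hτ1, hρ1, hτ2, hρ2⟩, h⟩ := hK.exists_forall_le_zero
    (G := g1 '' stdSimplex ℝ S1 ∪ g2 '' stdSimplex ℝ S1 ∪
      (g3 '' stdSimplex ℝ S2 ∪ g4 '' stdSimplex ℝ S2))
    (by
      rintro _ ((⟨σ, -, rfl⟩ | ⟨σ, -, rfl⟩) | (⟨σ, -, rfl⟩ | ⟨σ, -, rfl⟩)) <;>
      exact (continuous_EU _ (by fun_prop) (by fun_prop)).sub
        (continuous_EU _ (by fun_prop) (by fun_prop)))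
    (by
      intro δ hδ
      obtain ⟨τ1, hτ1, ρ1, hρ1, τ2, hτ2, ρ2, hρ2, h1, h2, h3, h4⟩ :=
        exists_approx_safe_equilibrium u1 u2 hε1 hε2 hδ
      refine ⟨(τ1, ρ1, τ2, ρ2), ⟨hτ1, hρ1, hτ2, hρ2⟩, ?_⟩
      rintro _ ((⟨σ, hσ, rfl⟩ | ⟨σ, hσ, rfl⟩) | (⟨σ, hσ, rfl⟩ | ⟨σ, hσ, rfl⟩))
      · exact sub_le_iff_le_add'.2 (h1 σ hσ)
      · exact sub_le_iff_le_add'.2 (h2 σ hσ)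
      · exact sub_le_iff_le_add'.2 (h3 σ hσ)
      · exact sub_le_iff_le_add'.2 (h4 σ hσ))
  refine ⟨_, _, convexCombo_mem_stdSimplex hε1 hτ1 hρ1, convexCombo_mem_stdSimplex hε2 hτ2 hρ2,
    τ1, ρ1, τ2, ρ2, hτ1, hρ1, hτ2, hρ2, rfl, rfl, fun σ hσ => ?_, fun σ hσ => ?_, fun σ hσ => ?_,
    fun σ hσ => ?_⟩
  · exact sub_nonpos.1 (h (g1 σ) (Or.inl (Or.inl ⟨σ, hσ, rfl⟩)))
  · exact sub_nonpos.1 (h (g2 σ) (Or.inl (Or.inr ⟨σ, hσ, rfl⟩)))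
  · exact sub_nonpos.1 (h (g3 σ) (Or.inr (Or.inl ⟨σ, hσ, rfl⟩)))
  · exact sub_nonpos.1 (h (g4 σ) (Or.inr (Or.inr ⟨σ, hσ, rfl⟩)))
end

section
/- For every n-player finite strategic-form game G (with n ≥ 2, a designated player 1) and every vector of parameters ε = (ε₂, …, εₙ) with εᵢ ∈ [0,1], there exists an ε-safe equilibrium of G. -/
open Finset

/-- Expected utility in an `n`-player strategic-form game, extended multilinearly
to mixed-strategy profiles. -/
def EUn {n : ℕ} {S : Fin n → Type*} [∀ i, Fintype (S i)]
    (u : (∀ i, S i) → ℝ) (σ : ∀ i, S i → ℝ) : ℝ :=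
  ∑ s : ∀ i, S i, (∏ i, σ i (s i)) * u s

section Scarf

variable {X I : Type*}

/-- A set `σ` is dominant for the family of orders `r` if no point lies strictly above the
minimum of `σ` in all the orders at once. -/
def Dominant (r : I → X → ℕ) (σ : Finset X) : Prop :=
  ∀ y, ∃ i, ∀ x ∈ σ, r i y ≤ r i x

theorem Dominant.mono {r : I → X → ℕ} {σ ω : Finset X} (h : Dominant r ω)
    (hs : σ ⊆ ω) :
    Dominant r σ := fun y => (h y).imp fun _ hi x hx => hi x (hs hx)

/-- `x` is maximal in order `i` among the points exceeding `m k` in every order `k ≠ i`. -/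
def IsPivot (r : I → X → ℕ) (m : I → X) (i : I) (x : X) : Prop :=
  (∀ k, k ≠ i → r k (m k) < r k x) ∧
    ∀ y, (∀ k, k ≠ i → r k (m k) < r k y) → r i y ≤ r i x

theorem existsUnique_isPivot [Fintype X] {r : I → X → ℕ} (hr : ∀ i, Function.Injective (r i))
    {m : I → X}
    {i : I} (hne : ∃ y, ∀ k, k ≠ i → r k (m k) < r k y) : ∃! x, IsPivot r m i x := by
  classical
  obtain ⟨y, hy⟩ := hne
  obtain ⟨x, hx, hmax⟩ := Finset.exists_max_image
    (univ.filter fun y => ∀ k, k ≠ i → r k (m k) < r k y) (r i) ⟨y, by simpa using hy⟩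
  simp only [mem_filter, mem_univ, true_and] at hx hmax
  exact ⟨x, ⟨hx, hmax⟩, fun z hz => hr i (le_antisymm (hmax z hz.1) (hz.2 x hx))⟩

variable [Fintype X] [DecidableEq X] [Fintype I] [DecidableEq I]

/-- A dominant set of one point fewer than there are orders, over which both possible pivots
exist, extends to a dominant set in exactly two ways. -/
theorem card_dominant_insert_eq_two {r : I → X → ℕ} (hr : ∀ i, Function.Injective (r i))
    {σ : Finset X} (hne : σ.Nonempty) (hσ : Dominant r σ) (hcard : σ.card + 1 = Fintype.card I)
    (hM : ∀ i, ∃ y, ∀ k, k ≠ i → ∃ x ∈ σ, r k x < r k y)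
    [DecidablePred fun x => x ∉ σ ∧ Dominant r (insert x σ)] :
    (univ.filter fun x => x ∉ σ ∧ Dominant r (insert x σ)).card = 2 := by
  classical
  choose m hm hmin using fun i => Finset.exists_min_image σ (r i) hne
  have hsurj : ∀ x ∈ σ, ∃ i, m i = x := fun x hx => by
    obtain ⟨i, hi⟩ := hσ x
    exact ⟨i, hr i (le_antisymm (hmin i x hx) (hi _ (hm i)))⟩
  obtain ⟨a, -, b, -, hab, hmab⟩ := Finset.exists_ne_map_eq_of_card_lt_of_maps_to
    (s := (univ : Finset I)) (t := σ) (by rw [card_univ]; omega) (f := m) (fun i _ => hm i)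
  have himg : ∀ i, i = a ∨ i = b → ∀ x ∈ σ, ∃ k, k ≠ i ∧ m k = x := by
    intro i hi x hx
    obtain ⟨k, rfl⟩ := hsurj x hx
    by_cases hk : k = i
    · rcases hi with rfl | rfl
      · exact ⟨b, hab.symm, by rw [hk, hmab]⟩
      · exact ⟨a, hab, by rw [hk, hmab]⟩
    · exact ⟨k, hk, rfl⟩
  have hle : ∀ i x, IsPivot r m i x → r i x ≤ r i (m i) := by
    intro i x hx
    obtain ⟨k, hk⟩ := hσ x
    by_cases hki : k = i
    · exact hki ▸ hk _ (hm k)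
    · exact absurd (hx.1 k hki) (not_lt.2 (hk _ (hm k)))
  have hiff : ∀ x, (x ∉ σ ∧ Dominant r (insert x σ)) ↔ IsPivot r m a x ∨ IsPivot r m b x := by
    intro x
    constructor
    · rintro ⟨hx, hd⟩
      obtain ⟨i, hi⟩ := hd x
      have hlt : r i x < r i (m i) := lt_of_le_of_ne (hi _ (mem_insert_of_mem (hm i)))
        fun h => hx (hr i h ▸ hm i)
      have hsub : σ ⊆ (univ.filter fun k => r k (m k) < r k x).image m := by
        intro y hy
        obtain ⟨k, hk⟩ := hd y
        have h1 : m k = y :=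
          hr k (le_antisymm (hmin k y hy) (hk _ (mem_insert_of_mem (hm k))))
        refine mem_image.2 ⟨k, by
          simp only [mem_filter, mem_univ, true_and]
          refine lt_of_le_of_ne (h1 ▸ hk x (mem_insert_self _ _)) fun h => hx (hr k h ▸ hm k), h1⟩
      have hsub' : (univ.filter fun k => r k (m k) < r k x) ⊆ univ.erase i := by
        intro k hk
        simp only [mem_filter, mem_univ, true_and] at hk
        refine mem_erase.2 ⟨?_, mem_univ _⟩
        rintro rfl
        exact lt_asymm hk hlt
      have hc1 := (card_le_card hsub)
      have hc2 := card_image_le (s := univ.filter fun k => r k (m k) < r k x) (f := m)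
      have hc3 := card_le_card hsub'
      have hc4 : (univ.erase i).card = σ.card := by
        rw [card_erase_of_mem (mem_univ _), card_univ]; omega
      have heq : (univ.filter fun k => r k (m k) < r k x) = univ.erase i :=
        eq_of_subset_of_card_le hsub' (by omega)
      have hinj : Set.InjOn m (univ.filter fun k => r k (m k) < r k x) :=
        card_image_iff.1 (by omega)
      rw [heq] at hinj
      have hlow : ∀ k, k ≠ i → r k (m k) < r k x := by
        intro k hk
        have : k ∈ univ.erase i := mem_erase.2 ⟨hk, mem_univ _⟩
        rw [← heq] at this
        simpa using this
      have hp : IsPivot r m i x := by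
        refine ⟨hlow, fun y hy => ?_⟩
        obtain ⟨k, hk⟩ := hd y
        by_cases hki : k = i
        · exact hki ▸ hk x (mem_insert_self _ _)
        · exact absurd (hy k hki) (not_lt.2 (hk _ (mem_insert_of_mem (hm k))))
      by_cases hia : i = a
      · exact Or.inl (hia ▸ hp)
      by_cases hib : i = b
      · exact Or.inr (hib ▸ hp)
      exact absurd (hinj (by simpa using Ne.symm hia) (by simpa using Ne.symm hib) hmab) hab
    · intro h
      obtain ⟨i, hi, hp⟩ : ∃ i, (i = a ∨ i = b) ∧ IsPivot r m i x := by
        rcases h with h | h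
        · exact ⟨a, Or.inl rfl, h⟩
        · exact ⟨b, Or.inr rfl, h⟩
      refine ⟨fun hx => ?_, fun y => ?_⟩
      · obtain ⟨k, hk, rfl⟩ := himg i hi x hx
        exact lt_irrefl _ (hp.1 k hk)
      · by_cases hy : ∀ k, k ≠ i → r k (m k) < r k y
        · refine ⟨i, fun z hz => ?_⟩
          rcases mem_insert.1 hz with rfl | hz
          · exact hp.2 y hy
          · exact (hp.2 y hy).trans ((hle i x hp).trans (hmin i z hz))
        · push Not at hy
          obtain ⟨k, hk, hky⟩ := hy
          refine ⟨k, fun z hz => ?_⟩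
          rcases mem_insert.1 hz with rfl | hz
          · exact hky.trans (hp.1 k hk).le
          · exact hky.trans (hmin k z hz)
  have hM' : ∀ i, ∃ y, ∀ k, k ≠ i → r k (m k) < r k y := fun i => by
    obtain ⟨y, hy⟩ := hM i
    refine ⟨y, fun k hk => ?_⟩
    obtain ⟨x, hx, hxy⟩ := hy k hk
    exact (hmin k x hx).trans_lt hxy
  obtain ⟨p, hp, hpu⟩ := existsUnique_isPivot hr (hM' a)
  obtain ⟨q, hq, hqu⟩ := existsUnique_isPivot hr (hM' b)
  have hpq : p ≠ q := by
    rintro rfl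
    exact lt_irrefl _ ((hq.1 a hab).trans_le (hle a p hp))
  rw [card_eq_two]
  refine ⟨p, q, hpq, ?_⟩
  ext x
  simp only [mem_filter, mem_univ, true_and, mem_insert, mem_singleton, hiff]
  constructor
  · rintro (h | h)
    · exact Or.inl (hpu x h)
    · exact Or.inr (hqu x h)
  · rintro (rfl | rfl)
    · exact Or.inl hp
    · exact Or.inr hq

/-- Deleting one point from a non-rainbow set leaves exactly the colours other than `i₀` in an
even number of ways. -/
theorem even_card_erase_image {c : X → I} {i₀ : I} {ω : Finset X}
    (hcard : ω.card = Fintype.card I) (hc : ω.image c ≠ univ) :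
    Even (univ.filter fun x => x ∈ ω ∧ (ω.erase x).image c = univ.erase i₀).card := by
  rcases (univ.filter fun x => x ∈ ω ∧ (ω.erase x).image c = univ.erase i₀).eq_empty_or_nonempty
    with h | ⟨x, hx⟩
  · simp [h]
  simp only [mem_filter, mem_univ, true_and] at hx
  obtain ⟨hxω, hx⟩ := hx
  have hne : c x ≠ i₀ := by
    intro h
    apply hc
    rw [← insert_erase hxω, image_insert, hx, h, insert_erase (mem_univ _)]
  have hmem : c x ∈ (ω.erase x).image c := by simpa [hx] using hne
  obtain ⟨z, hz, hzx⟩ := mem_image.1 hmem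
  obtain ⟨hzne, hzω⟩ := mem_erase.1 hz
  have hinj : Set.InjOn c (ω.erase x) := card_image_iff.1 (by
    rw [hx, card_erase_of_mem (mem_univ _), card_erase_of_mem hxω, card_univ, hcard])
  have key : (univ.filter fun x => x ∈ ω ∧ (ω.erase x).image c = univ.erase i₀) = {x, z} := by
    ext y
    simp only [mem_filter, mem_univ, true_and, mem_insert, mem_singleton]
    constructor
    · rintro ⟨hyω, hy⟩
      by_contra! hcon
      obtain ⟨hyx, hyz⟩ := hcon
      have hcy : c y ∈ (ω.erase y).image c := by
        rw [hy, ← hx]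
        exact mem_image_of_mem c (mem_erase.2 ⟨hyx, hyω⟩)
      obtain ⟨w, hw, hwy⟩ := mem_image.1 hcy
      obtain ⟨hwne, hwω⟩ := mem_erase.1 hw
      by_cases hwx : w = x
      · subst hwx
        exact hyz (hinj (mem_erase.2 ⟨hyx, hyω⟩) hz (by rw [hzx, hwy]))
      · exact hwne (hinj (mem_erase.2 ⟨hwx, hwω⟩) (mem_erase.2 ⟨hyx, hyω⟩) hwy)
    · rintro (rfl | rfl)
      · exact ⟨hxω, hx⟩
      · refine ⟨hzω, ?_⟩
        rw [← hx]
        ext j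
        simp only [mem_image, mem_erase]
        constructor
        · rintro ⟨w, ⟨hw, hwω⟩, rfl⟩
          by_cases hwx : w = x
          · exact ⟨y, ⟨hzne, hzω⟩, by rw [hzx, hwx]⟩
          · exact ⟨w, ⟨hwx, hwω⟩, rfl⟩
        · rintro ⟨w, ⟨hw, hwω⟩, rfl⟩
          by_cases hwz : w = y
          · exact ⟨x, ⟨hzne.symm, hxω⟩, by rw [hwz, hzx]⟩
          · exact ⟨w, ⟨hwz, hwω⟩, rfl⟩
  rw [key, card_pair hzne.symm]
  exact even_two

theorem sum_insert_eq_sum_erase {M : Type*} [AddCommMonoid M] (f : Finset X → Finset X → M) :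
    (∑ σ : Finset X, ∑ x : X, if x ∉ σ then f σ (insert x σ) else 0) =
      ∑ ω : Finset X, ∑ x : X, if x ∈ ω then f (ω.erase x) ω else 0 := by
  rw [sum_comm, sum_comm (s := (univ : Finset (Finset X)))]
  refine sum_congr rfl fun x _ => ?_
  rw [← sum_filter, ← sum_filter]
  refine sum_nbij' (fun σ => insert x σ) (fun ω => ω.erase x) ?_ ?_ ?_ ?_ ?_
  · simp
  · simp
  · intro σ hσ
    exact erase_insert (by simpa using hσ)
  · intro ω hω
    exact insert_erase (by simpa using hω)
  · intro σ hσ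
    rw [erase_insert (by simpa using hσ)]

/-- Scarf's lemma, for a family of orders with slack vertices `e i`: there is a dominant set
carrying every colour exactly once. -/
theorem exists_dominant_rainbow {r : I → X → ℕ} (hr : ∀ i, Function.Injective (r i))
    {e : I → X} (hmin : ∀ i x, x ≠ e i → r i (e i) < r i x)
    (hmax : ∀ k j x, k ≠ j → x ∉ Set.range e → r k x < r k (e j))
    (hT : ∃ x, x ∉ Set.range e) {c : X → I} (hc : ∀ i, c (e i) = i) (i₀ : I) :
    ∃ ω : Finset X, Dominant r ω ∧ ω.card = Fintype.card I ∧ ω.image c = univ := by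
  classical
  by_contra! hcon
  have hinj : Function.Injective e := fun i j h => by rw [← hc i, h, hc]
  let f : Finset X → Finset X → ZMod 2 := fun σ ω =>
    if Dominant r ω ∧ σ.card + 1 = Fintype.card I ∧ σ.image c = univ.erase i₀ then 1 else 0
  let outer : Finset X := (univ.erase i₀).image e
  have houter_c : outer.image c = univ.erase i₀ := by
    rw [image_image, show c ∘ e = id from funext hc, image_id]
  have houter_card : outer.card + 1 = Fintype.card I := by
    rw [card_image_of_injective _ hinj, card_erase_add_one (mem_univ _), card_univ]
  have hright : (∑ ω : Finset X, ∑ x : X, if x ∈ ω then f (ω.erase x) ω else 0) = 0 := by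
    refine sum_eq_zero fun ω _ => ?_
    by_cases hω : Dominant r ω ∧ ω.card = Fintype.card I
    · have := even_card_erase_image (i₀ := i₀) hω.2 (hcon ω hω.1 hω.2)
      rw [← ZMod.natCast_eq_zero_iff_even, card_filter, Nat.cast_sum] at this
      refine Eq.trans (sum_congr rfl fun x _ => ?_) this
      by_cases hx : x ∈ ω
      · have hcard := (card_erase_add_one hx).trans hω.2
        simp only [f, hx, hω.1, hcard, true_and, if_true]
        split_ifs <;> simp
      · simp [hx]
    · refine sum_eq_zero fun x _ => ?_
      by_cases hx : x ∈ ω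
      · have := card_erase_add_one hx
        simp only [hx, if_true, f, this]
        rw [if_neg]
        tauto
      · simp [hx]
  have hleft : (∑ σ : Finset X, ∑ x : X, if x ∉ σ then f σ (insert x σ) else 0) = 1 := by
    have hrw : ∀ σ : Finset X, σ.card + 1 = Fintype.card I → σ.image c = univ.erase i₀ →
        (∑ x : X, if x ∉ σ then f σ (insert x σ) else 0) =
          ((univ.filter fun x => x ∉ σ ∧ Dominant r (insert x σ)).card : ZMod 2) := by
      intro σ h1 h2
      rw [card_filter, Nat.cast_sum]
      refine sum_congr rfl fun x _ => ?_
      by_cases hx : x ∈ σ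
      · simp [hx]
      · by_cases hd : Dominant r (insert x σ) <;> simp [f, h1, h2, hx, hd]
    rw [sum_eq_single outer]
    · rw [hrw outer houter_card houter_c]
      obtain ⟨t, ht, htmax⟩ := Finset.exists_max_image (univ.filter fun x => x ∉ Set.range e)
        (r i₀) (by obtain ⟨x, hx⟩ := hT; exact ⟨x, by simpa using hx⟩)
      simp only [mem_filter, mem_univ, true_and] at ht htmax
      have hkey : (univ.filter fun x => x ∉ outer ∧ Dominant r (insert x outer)) = {t} := by
        ext x
        simp only [mem_filter, mem_univ, true_and, mem_singleton]
        constructor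
        · rintro ⟨hx, hd⟩
          obtain ⟨k, hk⟩ := hd t
          have hki : k = i₀ := by
            by_contra hki
            have := hk (e k) (mem_insert_of_mem
              (mem_image_of_mem e (mem_erase.2 ⟨hki, mem_univ _⟩)))
            exact absurd (hmin k t fun h => ht ⟨k, h.symm⟩) (not_lt.2 this)
          subst hki
          have htx := hk x (mem_insert_self _ _)
          have hxr : x ∉ Set.range e := by
            rintro ⟨j, rfl⟩
            by_cases hj : j = k
            · subst hj
              exact absurd (hmin j t fun h => ht ⟨j, h.symm⟩) (not_lt.2 htx)
            · exact hx (mem_image_of_mem e (mem_erase.2 ⟨hj, mem_univ _⟩))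
          exact hr k (le_antisymm (htmax x hxr) htx)
        · rintro rfl
          refine ⟨fun h => ?_, fun y => ?_⟩
          · obtain ⟨j, -, hj⟩ := mem_image.1 h
            exact ht ⟨j, hj⟩
          · by_cases hy : ∃ k, y = e k
            · obtain ⟨k, rfl⟩ := hy
              refine ⟨k, fun z _ => ?_⟩
              by_cases hz : z = e k
              · rw [hz]
              · exact (hmin k z hz).le
            · have hy' : y ∉ Set.range e := fun ⟨k, hk⟩ => hy ⟨k, hk.symm⟩
              refine ⟨i₀, fun z hz => ?_⟩
              rcases mem_insert.1 hz with rfl | hz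
              · exact htmax y hy'
              · obtain ⟨j, hj, rfl⟩ := mem_image.1 hz
                exact (hmax i₀ j y (ne_of_mem_erase hj).symm hy').le
      rw [hkey]
      simp
    · intro σ _ hσ
      by_cases h : Dominant r σ ∧ σ.card + 1 = Fintype.card I ∧ σ.image c = univ.erase i₀
      · obtain ⟨hd, hcard, hcol⟩ := h
        have hex : ∃ t ∈ σ, t ∉ Set.range e := by
          by_contra! hall
          apply hσ
          refine eq_of_subset_of_card_le (fun x hx => ?_) (by omega)
          obtain ⟨j, rfl⟩ := hall x hx
          have := mem_image_of_mem c hx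
          rw [hcol, hc] at this
          exact mem_image_of_mem e this
        obtain ⟨t, htσ, ht⟩ := hex
        rw [hrw σ hcard hcol, card_dominant_insert_eq_two hr ⟨t, htσ⟩ hd hcard
          fun i => ⟨e i, fun k hk => ⟨t, htσ, hmax k i t hk ht⟩⟩]
        rfl
      · refine sum_eq_zero fun x _ => ?_
        split_ifs
        · rfl
        · exact if_neg fun h' => h ⟨h'.1.mono (subset_insert _ _), h'.2⟩
    · simp
  rw [sum_insert_eq_sum_erase, hright] at hleft
  exact zero_ne_one hleft

end Scarf

section Brouwer

/-- For every colouring of the integer points of a dilated simplex, some point has, for each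
colour `i`, either a nearby point coloured `i` or a small `i`-th coordinate. -/
theorem exists_near_rainbow {I : Type*} [Fintype I] [Nonempty I] (N : ℕ) (c : (I → ℕ) → I) :
    ∃ t₀ : I → ℕ, ∑ i, t₀ i = N ∧ ∀ i,
      (∃ t : I → ℕ, ∑ i, t i = N ∧ c t = i ∧
        ∀ k, t k ≤ t₀ k + Fintype.card I ∧ t₀ k ≤ t k + Fintype.card I) ∨
      t₀ i ≤ Fintype.card I := by
  classical
  let T := ↥(Finset.piAntidiag (univ : Finset I) N)
  have hTsum : ∀ t : T, ∑ i, t.1 i = N := fun t => (Finset.mem_piAntidiag.1 t.2).1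
  have hTle : ∀ (t : T) i, t.1 i ≤ N := fun t i =>
    (single_le_sum (f := t.1) (fun _ _ => Nat.zero_le _) (mem_univ i)).trans_eq (hTsum t)
  let mk : ∀ t : I → ℕ, ∑ i, t i = N → T := fun t ht =>
    ⟨t, Finset.mem_piAntidiag.2 ⟨ht, fun _ _ => mem_univ _⟩⟩
  set M := Fintype.card T with hMdef
  let en : T ≃ Fin M := Fintype.equivFin T
  let eI : I ≃ Fin (Fintype.card I) := Fintype.equivFin I
  set B := 1 + (N + 1) * M with hB
  let r : I → T ⊕ I → ℕ := fun i => Sum.elim (fun t => 1 + (t.1 i * M + en t))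
    (fun j => if j = i then 0 else B + eI j)
  have hrB : ∀ i t, r i (Sum.inl t) < B := fun i t => by
    have h1 := Nat.mul_le_mul_right M (hTle t i)
    have h2 := (en t).2
    simp only [r, Sum.elim_inl, hB]
    linarith [add_mul N 1 M]
  have hrle : ∀ i s t, r i (Sum.inl s) ≤ r i (Sum.inl t) → s.1 i ≤ t.1 i := fun i s t h => by
    simp only [r, Sum.elim_inl] at h
    by_contra! hlt
    have h1 := Nat.mul_le_mul_right M hlt
    have h2 := (en t).2
    rw [Nat.succ_mul] at h1
    omega
  have hr : ∀ i, Function.Injective (r i) := by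
    rintro i (s | j) (t | k) h
    · have hst : s.1 i = t.1 i := le_antisymm (hrle i s t h.le) (hrle i t s h.ge)
      simp only [r, Sum.elim_inl, hst] at h
      rw [en.injective (Fin.ext (by omega : (en s : ℕ) = en t))]
    · have := hrB i s
      rw [h] at this
      simp only [r, Sum.elim_inl, Sum.elim_inr] at h this
      split_ifs at h this <;> omega
    · have := hrB i t
      rw [← h] at this
      simp only [r, Sum.elim_inl, Sum.elim_inr] at h this
      split_ifs at h this <;> omega
    · simp only [r, Sum.elim_inr] at h
      split_ifs at h with h1 h2 h2
      · rw [h1, h2]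
      · omega
      · omega
      · rw [eI.injective (Fin.ext (by omega : (eI j : ℕ) = eI k))]
  have hself : ∀ i, r i (Sum.inr i) = 0 := fun i => by simp [r]
  have hslackmin : ∀ i x, x ≠ Sum.inr i → r i (Sum.inr i) < r i x := fun i x hx => by
    rw [hself]
    refine Nat.pos_of_ne_zero fun h => hx (hr i (by rw [h, hself]))
  have hslackmax : ∀ (k j : I) (x : T ⊕ I), k ≠ j → x ∉ Set.range (Sum.inr : I → T ⊕ I) →
      r k x < r k (Sum.inr j) := by
    rintro k j (t | l) hkj hx
    · refine (hrB k t).trans_le ?_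
      simp [r, hkj.symm]
    · exact absurd ⟨l, rfl⟩ hx
  obtain ⟨i₀⟩ := ‹Nonempty I›
  have hT : ∃ x : T ⊕ I, x ∉ Set.range (Sum.inr : I → T ⊕ I) :=
    ⟨Sum.inl (mk (Pi.single i₀ N) (by simp)), by simp⟩
  obtain ⟨ω, hd, -, hcol⟩ := exists_dominant_rainbow hr (e := Sum.inr) hslackmin hslackmax hT
    (c := Sum.elim (fun t : T => c t.1) id) (fun _ => rfl) i₀
  have hdom : ∀ y : T, ∃ k, Sum.inr k ∉ ω ∧ ∀ t : T, Sum.inl t ∈ ω → y.1 k ≤ t.1 k := by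
    intro y
    obtain ⟨k, hk⟩ := hd (Sum.inl y)
    refine ⟨k, fun h => ?_, fun t ht => hrle k y t (hk _ ht)⟩
    exact absurd (hslackmin k (Sum.inl y) (by simp)) (not_lt.2 (hk _ h))
  have hrain : ∀ i, Sum.inr i ∉ ω → ∃ t : T, Sum.inl t ∈ ω ∧ c t.1 = i := by
    intro i hi
    obtain ⟨x, hx, hxi⟩ := mem_image.1 (hcol ▸ mem_univ i : i ∈ ω.image _)
    rcases x with t | j
    · exact ⟨t, hx, hxi⟩
    · exact absurd ((show j = i from hxi) ▸ hx) hi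
  obtain ⟨k₀, hk₀, -⟩ := hdom (mk (Pi.single i₀ N) (by simp))
  obtain ⟨t₀, ht₀, -⟩ := hrain k₀ hk₀
  let C : Finset I := univ.filter fun k => Sum.inr k ∉ ω
  have hC : ∀ k, k ∈ C ↔ Sum.inr k ∉ ω := by simp [C]
  choose m hm hmin using fun k => Finset.exists_min_image
    (univ.filter fun t : T => Sum.inl t ∈ ω) (fun t => t.1 k) ⟨t₀, by simpa using ht₀⟩
  simp only [mem_filter, mem_univ, true_and] at hm hmin
  have hbig : N < ∑ k ∈ C, ((m k).1 k + 1) := by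
    by_contra! hle
    let y : I → ℕ := fun k => (if k ∈ C then (m k).1 k + 1 else 0) +
      (Pi.single k₀ (N - ∑ k ∈ C, ((m k).1 k + 1)) : I → ℕ) k
    have hy : ∑ k, y k = N := by
      simp only [y]
      rw [sum_add_distrib, sum_ite_mem, univ_inter, sum_pi_single', if_pos (mem_univ _)]
      omega
    obtain ⟨k, hk, hyk⟩ := hdom (mk y hy)
    have h1 : y k ≤ (m k).1 k := hyk (m k) (hm k)
    simp only [y, (hC k).2 hk, if_true] at h1
    omega
  have hclose : ∀ t : T, Sum.inl t ∈ ω → (∑ k ∈ C, (t.1 k - (m k).1 k)) + ∑ k ∈ Cᶜ, t.1 k ≤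
      Fintype.card I := by
    intro t ht
    have h1 := hTsum t
    rw [← sum_add_sum_compl C] at h1
    have h2 : ∑ k ∈ C, t.1 k = (∑ k ∈ C, (t.1 k - (m k).1 k)) + ∑ k ∈ C, (m k).1 k := by
      rw [← sum_add_distrib]
      exact sum_congr rfl fun k _ => (Nat.sub_add_cancel (hmin k t ht)).symm
    have h3 := card_le_univ C
    rw [sum_add_distrib, ← card_eq_sum_ones] at hbig
    omega
  have hcloseC : ∀ t : T, Sum.inl t ∈ ω → ∀ k ∈ C, t.1 k ≤ (m k).1 k + Fintype.card I := by
    intro t ht k hk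
    have h1 := single_le_sum (f := fun k => t.1 k - (m k).1 k) (fun _ _ => Nat.zero_le _) hk
    have h2 := hclose t ht
    omega
  have hcloseC' : ∀ t : T, Sum.inl t ∈ ω → ∀ k, k ∉ C → t.1 k ≤ Fintype.card I := by
    intro t ht k hk
    have h1 := single_le_sum (f := t.1) (fun _ _ => Nat.zero_le _) (mem_compl.2 hk)
    have h2 := hclose t ht
    omega
  refine ⟨t₀.1, hTsum t₀, fun i => ?_⟩
  by_cases hi : Sum.inr i ∈ ω
  · exact Or.inr (hcloseC' t₀ ht₀ i (by simpa [hC] using hi))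
  · obtain ⟨t, ht, hti⟩ := hrain i hi
    refine Or.inl ⟨t.1, hTsum t, hti, fun k => ?_⟩
    by_cases hk : k ∈ C
    · have h1 := hcloseC t ht k hk
      have h2 := hcloseC t₀ ht₀ k hk
      have h3 := hmin k t ht
      have h4 := hmin k t₀ ht₀
      omega
    · have h1 := hcloseC' t ht k hk
      have h2 := hcloseC' t₀ ht₀ k hk
      omega

theorem div_mem_stdSimplex {I : Type*} [Fintype I] {N : ℕ} {t : I → ℕ} (ht : ∑ i, t i = N + 1) :
    (fun i => (t i : ℝ) / (N + 1)) ∈ stdSimplex ℝ I := by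
  refine ⟨fun i => by positivity, ?_⟩
  rw [← sum_div, ← Nat.cast_sum, ht]
  push_cast
  exact div_self (by positivity)

/-- **Brouwer's fixed point theorem** on the standard simplex. -/
theorem exists_fixedPoint_stdSimplex {I : Type*} [Fintype I] [Nonempty I] {f : (I → ℝ) → I → ℝ}
    (hf : ContinuousOn f (stdSimplex ℝ I))
    (hmaps : Set.MapsTo f (stdSimplex ℝ I) (stdSimplex ℝ I)) :
    ∃ x ∈ stdSimplex ℝ I, f x = x := by
  classical
  have hlabel : ∀ x, ∃ i, x ∈ stdSimplex ℝ I → x i ≤ f x i := by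
    intro x
    by_contra! h
    have hx := (h (Classical.arbitrary I)).1
    have := sum_lt_sum_of_nonempty univ_nonempty fun i (_ : i ∈ univ) => (h i).2
    rw [hx.2, (hmaps hx).2] at this
    exact lt_irrefl _ this
  choose label hlabel using hlabel
  have hseq : ∀ N : ℕ, ∃ x ∈ stdSimplex ℝ I, ∀ i,
      (∃ y ∈ stdSimplex ℝ I, y i ≤ f y i ∧ dist y x ≤ Fintype.card I / ((N : ℝ) + 1)) ∨
      x i ≤ Fintype.card I / ((N : ℝ) + 1) := by
    intro N
    obtain ⟨t₀, ht₀, h⟩ := exists_near_rainbow (I := I) (N + 1)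
      fun t => label fun i => (t i : ℝ) / (N + 1)
    have hN : (0 : ℝ) < N + 1 := by positivity
    refine ⟨_, div_mem_stdSimplex ht₀, fun i => ?_⟩
    rcases h i with ⟨t, ht, hti, hclose⟩ | h
    · refine Or.inl ⟨_, div_mem_stdSimplex ht, ?_, ?_⟩
      · have := hlabel _ (div_mem_stdSimplex ht)
        rwa [hti] at this
      · refine (dist_pi_le_iff (by positivity)).2 fun k => ?_
        rw [Real.dist_eq, ← sub_div, abs_div, abs_of_pos hN]
        gcongr
        have h1 : (t k : ℝ) ≤ t₀ k + Fintype.card I := mod_cast (hclose k).1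
        have h2 : (t₀ k : ℝ) ≤ t k + Fintype.card I := mod_cast (hclose k).2
        rw [abs_le]
        constructor <;> linarith
    · right
      gcongr
  choose X hX hXi using hseq
  obtain ⟨x, hx, φ, hφ, hlim⟩ := (isCompact_stdSimplex ℝ I).tendsto_subseq hX
  refine ⟨x, hx, ?_⟩
  have hle : ∀ i, x i ≤ f x i := by
    intro i
    by_contra! hlt
    have hpos : 0 < x i := ((hmaps hx).1 i).trans_lt hlt
    have hcont : ContinuousWithinAt (fun y => f y i - y i) (stdSimplex ℝ I) x :=
      ((continuous_apply i).continuousAt.comp_continuousWithinAt (hf x hx)).sub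
        (continuous_apply i).continuousWithinAt
    obtain ⟨δ, hδ, hball⟩ := Metric.mem_nhdsWithin_iff.1
      (hcont.eventually_lt_const (sub_neg.2 hlt))
    have hη : 0 < min δ (x i) / 2 := half_pos (lt_min hδ hpos)
    have hsmall : Filter.Tendsto (fun n : ℕ => (Fintype.card I : ℝ) / ((φ n : ℝ) + 1))
        Filter.atTop (nhds 0) := by
      have := (tendsto_one_div_add_atTop_nhds_zero_nat (𝕜 := ℝ)).const_mul (Fintype.card I : ℝ)
      simpa [div_eq_mul_inv, Function.comp_def] using this.comp hφ.tendsto_atTop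
    obtain ⟨n, hn1, hn2⟩ := ((Metric.tendsto_nhds.1 hlim _ hη).and
      (hsmall.eventually_lt_const hη)).exists
    have hmδ := min_le_left δ (x i)
    have hmx := min_le_right δ (x i)
    simp only [Function.comp_apply] at hn1
    rcases hXi (φ n) i with ⟨y, hy, hyi, hdist⟩ | h
    · have hyx : y ∈ Metric.ball x δ := by
        have := dist_triangle y (X (φ n)) x
        rw [Metric.mem_ball]
        linarith
      have : f y i - y i < 0 := hball ⟨hyx, hy⟩
      linarith
    · have h1 := (abs_lt.1 ((dist_le_pi_dist (X (φ n)) x i).trans_lt hn1)).1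
      linarith
  have hsum : ∑ i, x i = ∑ i, f x i := by rw [hx.2, (hmaps hx).2]
  funext i
  exact ((sum_eq_sum_iff_of_le fun i _ => hle i).1 hsum i (mem_univ i)).symm

variable {K : Type*} [Fintype K] [Nonempty K] {A : K → Type*} [∀ k, Fintype (A k)]
  [∀ k, Nonempty (A k)]

/-- Brouwer's fixed point theorem on a product of standard simplices. -/
theorem exists_fixedPoint_pi_stdSimplex {F : (∀ k, A k → ℝ) → ∀ k, A k → ℝ}
    (hF : Continuous F)
    (hmaps : ∀ x, (∀ k, x k ∈ stdSimplex ℝ (A k)) → ∀ k, F x k ∈ stdSimplex ℝ (A k)) :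
    ∃ x, (∀ k, x k ∈ stdSimplex ℝ (A k)) ∧ F x = x := by
  classical
  set n : ℝ := (Fintype.card K : ℝ) with hn
  have hn0 : 0 < n := by simp [hn, Fintype.card_pos]
  let mass : ((Σ k, A k) → ℝ) → K → ℝ := fun z k => n * ∑ a, z ⟨k, a⟩
  let R : ((Σ k, A k) → ℝ) → ∀ k, A k → ℝ := fun z k a =>
    (n * z ⟨k, a⟩ + max 0 (1 - mass z k) / Fintype.card (A k)) / max (mass z k) 1
  have hden : ∀ z k, 0 < max (mass z k) 1 := fun z k => lt_max_of_lt_right one_pos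
  have hRcont : Continuous R := by
    refine continuous_pi fun k => continuous_pi fun a => ?_
    refine Continuous.div ?_ ?_ fun z => (hden z k).ne'
    · simp only [mass]
      fun_prop
    · simp only [mass]
      fun_prop
  have hR : ∀ z ∈ stdSimplex ℝ (Σ k, A k), ∀ k, R z k ∈ stdSimplex ℝ (A k) := by
    intro z hz k
    refine ⟨fun a => ?_, ?_⟩
    · have := hz.1 ⟨k, a⟩
      have := hden z k
      simp only [R]
      positivity
    · have hA : (Fintype.card (A k) : ℝ) ≠ 0 := by simp
      simp only [R]
      rw [← sum_div, sum_add_distrib, ← mul_sum, sum_const, card_univ, nsmul_eq_mul,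
        mul_div_cancel₀ _ hA, div_eq_one_iff_eq (hden z k).ne']
      change mass z k + max 0 (1 - mass z k) = _
      rw [← max_add_add_left]
      simp
  have : Nonempty (Σ k, A k) := ⟨⟨Classical.arbitrary K, Classical.arbitrary _⟩⟩
  obtain ⟨z, hz, hfix⟩ := exists_fixedPoint_stdSimplex
    (I := Σ k, A k) (f := fun z p => F (R z) p.1 p.2 / n) (by
      refine Continuous.continuousOn (continuous_pi fun p => ?_)
      exact ((continuous_apply p.2).comp ((continuous_apply p.1).comp (hF.comp hRcont))).div_const
        n) (by
      intro z hz
      refine ⟨fun p => div_nonneg ((hmaps _ (hR z hz) p.1).1 p.2) hn0.le, ?_⟩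
      rw [← sum_div, Fintype.sum_sigma]
      simp only [fun k => (hmaps _ (hR z hz) k).2]
      simp [← hn, hn0.ne'])
  have hzF : ∀ k a, F (R z) k a = n * z ⟨k, a⟩ := fun k a => by
    have := congrFun hfix ⟨k, a⟩
    simp only at this
    rw [← this, mul_div_cancel₀ _ hn0.ne']
  have hmass : ∀ k, mass z k = 1 := fun k => by
    simp only [mass, mul_sum, ← hzF]
    exact (hmaps _ (hR z hz) k).2
  refine ⟨R z, hR z hz, ?_⟩
  funext k a
  rw [hzF]
  simp [R, hmass]

/-- Finitely many agents, each choosing a mixed strategy and evaluating its pure actions by a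
continuous function of the whole profile, have a Nash equilibrium. -/
theorem exists_agent_equilibrium (v : ∀ k, A k → (∀ k, A k → ℝ) → ℝ)
    (hv : ∀ k a, Continuous (v k a)) :
    ∃ x : ∀ k, A k → ℝ, (∀ k, x k ∈ stdSimplex ℝ (A k)) ∧
      ∀ k a, v k a x ≤ ∑ b, x k b * v k b x := by
  let avg : (∀ k, A k → ℝ) → K → ℝ := fun x k => ∑ b, x k b * v k b x
  let g : (∀ k, A k → ℝ) → ∀ k, A k → ℝ := fun x k a => max 0 (v k a x - avg x k)
  have hg : ∀ x k a, 0 ≤ g x k a := fun x k a => le_max_left _ _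
  have hden : ∀ x k, 0 < 1 + ∑ b, g x k b := fun x k =>
    add_pos_of_pos_of_nonneg one_pos (sum_nonneg fun b _ => hg x k b)
  have hgcont : ∀ k a, Continuous fun x => g x k a := fun k a => by
    simp only [g, avg]
    fun_prop
  obtain ⟨x, hx, hfix⟩ := exists_fixedPoint_pi_stdSimplex
    (F := fun x k a => (x k a + g x k a) / (1 + ∑ b, g x k b)) (by
      refine continuous_pi fun k => continuous_pi fun a => ?_
      exact Continuous.div (by fun_prop) (by fun_prop) fun x => (hden x k).ne') (by
      intro x hx k
      refine ⟨fun a => div_nonneg (add_nonneg ((hx k).1 a) (hg x k a)) (hden x k).le, ?_⟩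
      rw [← sum_div, sum_add_distrib, (hx k).2, div_self (hden x k).ne'])
  refine ⟨x, hx, fun k a => ?_⟩
  have hgx : ∀ b, g x k b = x k b * ∑ b, g x k b := fun b => by
    have := congrFun (congrFun hfix k) b
    rw [div_eq_iff (hden x k).ne'] at this
    linarith
  have hsq : ∀ b, g x k b * g x k b = (∑ b, g x k b) * (x k b * (v k b x - avg x k)) := fun b => by
    have h1 : g x k b * g x k b = g x k b * (v k b x - avg x k) := by
      simp only [g]
      rcases le_total 0 (v k b x - avg x k) with h | h
      · rw [max_eq_right h]
      · rw [max_eq_left h, zero_mul, zero_mul]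
    rw [h1]
    nth_rewrite 1 [hgx b]
    ring
  have hzero : ∑ b, g x k b * g x k b = 0 := by
    have : ∑ b, x k b * (v k b x - avg x k) = 0 := by
      simp only [mul_sub, sum_sub_distrib, ← sum_mul, (hx k).2, one_mul]
      exact sub_self _
    simp only [hsq, ← mul_sum, this, mul_zero]
  have h0 := mul_self_eq_zero.1
    ((sum_eq_zero_iff_of_nonneg fun b _ => mul_self_nonneg (g x k b)).1 hzero a (mem_univ a))
  exact sub_nonpos.1 (max_eq_left_iff.1 h0)

end Brouwer

section Safe

theorem EUn_update_eq_sum {n : ℕ} {S : Fin n → Type*} [∀ i, Fintype (S i)]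
    [∀ i, DecidableEq (S i)] (u : (∀ i, S i) → ℝ) (σ : ∀ i, S i → ℝ) (i : Fin n) (τ : S i → ℝ) :
    EUn u (Function.update σ i τ) =
      ∑ a, τ a * EUn u (Function.update σ i (Pi.single a 1)) := by
  have hprod : ∀ (τ : S i → ℝ) (s : ∀ i, S i), ∏ j, Function.update σ i τ j (s j) =
      τ (s i) * ∏ j ∈ univ.erase i, σ j (s j) := fun τ s => by
    rw [← mul_prod_erase univ _ (mem_univ i), Function.update_self]
    congr 1
    exact prod_congr rfl fun j hj => by rw [Function.update_of_ne (ne_of_mem_erase hj)]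
  simp only [EUn, hprod, mul_sum]
  rw [sum_comm]
  refine sum_congr rfl fun s _ => ?_
  rw [sum_eq_single (s i) (fun a _ ha => by simp [Pi.single_eq_of_ne ha.symm]) (by simp)]
  simp [mul_assoc]

/-- Linearity turns a bound on the payoffs of pure strategies into one for mixed strategies. -/
theorem EUn_update_le {n : ℕ} {S : Fin n → Type*} [∀ i, Fintype (S i)]
    [∀ i, DecidableEq (S i)] {u : (∀ i, S i) → ℝ} {σ : ∀ i, S i → ℝ} {i : Fin n} {b : ℝ}
    (h : ∀ a, EUn u (Function.update σ i (Pi.single a 1)) ≤ b) {τ : S i → ℝ}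
    (hτ : τ ∈ stdSimplex ℝ (S i)) : EUn u (Function.update σ i τ) ≤ b := by
  calc EUn u (Function.update σ i τ)
      = ∑ a, τ a * EUn u (Function.update σ i (Pi.single a 1)) := EUn_update_eq_sum u σ i τ
    _ ≤ ∑ a, τ a * b := sum_le_sum fun a _ => mul_le_mul_of_nonneg_left (h a) (hτ.1 a)
    _ = b := by rw [← sum_mul, hτ.2, one_mul]

theorem EUn_neg {n : ℕ} {S : Fin n → Type*} [∀ i, Fintype (S i)] (u : (∀ i, S i) → ℝ)
    (σ : ∀ i, S i → ℝ) : EUn (-u) σ = -EUn u σ := by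
  simp [EUn]

theorem continuous_EUn {n : ℕ} {S : Fin n → Type*} [∀ i, Fintype (S i)] (u : (∀ i, S i) → ℝ) :
    Continuous (EUn u) := by
  unfold EUn
  fun_prop

end Safe

/-- every n-player finite strategic-form game (n ≥ 2, designated
player 1 = index 0) has an ε-safe equilibrium for any ε with εᵢ ∈ [0,1]. -/
theorem safe_equilibrium_exists_n_player
    {n : ℕ} (S : Fin (n + 2) → Type*) [∀ i, Fintype (S i)] [∀ i, Nonempty (S i)]
    (u : Fin (n + 2) → (∀ i, S i) → ℝ)
    (ε : Fin (n + 2) → ℝ) (hε : ∀ i, ε i ∈ Set.Icc (0:ℝ) 1) :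
    ∃ σ : ∀ i, S i → ℝ,
      (∀ i, σ i ∈ stdSimplex ℝ (S i)) ∧
      -- player 1 (index 0) best responds to the others
      (∀ σ' ∈ stdSimplex ℝ (S 0),
        EUn (u 0) (Function.update σ 0 σ') ≤ EUn (u 0) σ) ∧
      -- every other player i mixes between a best response ρ and a strategy τ
      -- minimizing player 1's payoff, with weights (1 - ε i) and ε i
      (∀ i, i ≠ 0 → ∃ τ ρ : S i → ℝ,
        τ ∈ stdSimplex ℝ (S i) ∧ ρ ∈ stdSimplex ℝ (S i) ∧
        σ i = (fun s => ε i * τ s + (1 - ε i) * ρ s) ∧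
        (∀ σ' ∈ stdSimplex ℝ (S i),
          EUn (u i) (Function.update σ i σ') ≤ EUn (u i) (Function.update σ i ρ)) ∧
        (∀ σ' ∈ stdSimplex ℝ (S i),
          EUn (u 0) (Function.update σ i τ) ≤ EUn (u 0) (Function.update σ i σ'))) := by
  classical
  let w : Fin (n + 2) → ℝ := fun i => if i = 0 then 0 else ε i
  have hw : ∀ i, 0 ≤ w i ∧ w i ≤ 1 := fun i => by
    by_cases hi : i = 0
    · simp [w, hi]
    · simpa [w, hi] using hε i
  let P : (∀ k : Fin (n + 2) × Bool, S k.1 → ℝ) → ∀ i, S i → ℝ :=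
    fun x i s => w i * x (i, true) s + (1 - w i) * x (i, false) s
  have hP : Continuous P := by fun_prop
  let U : Fin (n + 2) × Bool → (∀ i, S i) → ℝ := fun k => if k.2 then -u 0 else u k.1
  obtain ⟨x, hx, hbest⟩ := exists_agent_equilibrium
    (A := fun k : Fin (n + 2) × Bool => S k.1)
    (fun k a x => EUn (U k) (Function.update (P x) k.1 (Pi.single a 1)))
    fun k a => (continuous_EUn _).comp (hP.update k.1 continuous_const)
  have hopt : ∀ k : Fin (n + 2) × Bool, ∀ σ' ∈ stdSimplex ℝ (S k.1),
      EUn (U k) (Function.update (P x) k.1 σ') ≤ EUn (U k) (Function.update (P x) k.1 (x k)) := by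
    intro k σ' hσ'
    refine EUn_update_le (fun a => ?_) hσ'
    rw [EUn_update_eq_sum _ _ _ (x k)]
    exact hbest k a
  refine ⟨P x, fun i => ?_, fun σ' hσ' => ?_, fun i hi =>
    ⟨x (i, true), x (i, false), hx (i, true), hx (i, false), ?_, fun σ' hσ' => ?_,
      fun σ' hσ' => ?_⟩⟩
  · exact convex_stdSimplex ℝ (S i) (hx (i, true)) (hx (i, false)) (hw i).1
      (sub_nonneg.2 (hw i).2) (add_sub_cancel _ _)
  · have h0 : P x 0 = x (0, false) := by
      funext s
      simp [P, w]
    have h := hopt (0, false) σ' hσ'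
    rw [← h0] at h
    simpa [U] using h
  · simp [P, w, hi]
  · simpa [U] using hopt (i, false) σ' hσ'
  · simpa [U, EUn_neg] using hopt (i, true) σ' hσ'
end
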